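/- For every λ ∈ 𝔫*, the map ψ ↦ Ind_{S_λ}^G(ψ) is a bijection from the set Irr(S_λ, Ind_{L_λ}^{S_λ}(θ_λ)) of irreducible constituents of Ind_{L_λ}^{S_λ}(θ_λ) onto the set Irr(G, χ_λ) of irreducible constituents of χ_λ = Ind_{L_λ}^G(θ_λ). -/

import Mathlib

open scoped Classical BigOperators ComplexOrder

set_option linter.unusedSectionVars false
set_option linter.unusedVariables false

noncomputable section

namespace IterChar

/-! ### Generic notions for finite groups: inner product, induction, characters -/

/-- The standard inner product `⟨f,h⟩_G = |G|⁻¹ ∑_{x ∈ G} f x * conj (h x)`. -/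
def innerG (G : Type) [Group G] (f h : G → ℂ) : ℂ :=
  (Nat.card G : ℂ)⁻¹ * ∑ᶠ x : G, f x * (starRingEnd ℂ) (h x)

/-- Induction of a function from a subgroup, via the Frobenius formula. -/
def indFun {G : Type} [Group G] (H : Subgroup G) (ψ : ↥H → ℂ) : G → ℂ :=
  fun g => (Nat.card ↥H : ℂ)⁻¹ *
    ∑ᶠ x : G, if h : x * g * x⁻¹ ∈ H then ψ ⟨x * g * x⁻¹, h⟩ else 0

/-- A function `G → ℂ` is a character if it is the trace character of some
finite-dimensional complex representation. -/
def IsCharacter (G : Type) [Group G] (f : G → ℂ) : Prop :=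
  ∃ V : FDRep ℂ G, f = FDRep.character V

/-- The set of irreducible characters of `G`: characters of norm one. -/
def Irr (G : Type) [Group G] : Set (G → ℂ) :=
  {f | IsCharacter G f ∧ innerG G f f = 1}

/-- The set of irreducible constituents of `χ`: irreducible characters with
`⟨χ, ψ⟩_G > 0` (using the complex partial order). -/
def IrrConstituents (G : Type) [Group G] (χ : G → ℂ) : Set (G → ℂ) :=
  {f | f ∈ Irr G ∧ 0 < innerG G χ f}

/-! ### Algebra groups -/

variable {F : Type} [Field F] [Fintype F] {R : Type} [Ring R] [Algebra F R] [Fintype R]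

/-- `J` is a nilpotent (non-unital) subalgebra: all products of some fixed length vanish. -/
def IsNil (J : NonUnitalSubalgebra F R) : Prop :=
  ∃ N : ℕ, ∀ l : List R, (∀ x ∈ l, x ∈ J) → l.length = N → l.prod = 0

/-- The algebra group `G = 1 + J` of a (nilpotent) subalgebra `J ⊆ R`, realized as the
subgroup of units `u` of `R` with `u - 1 ∈ J` (and `u⁻¹ - 1 ∈ J`, which is automatic
when `J` is nilpotent). -/
def algGroup (F : Type) [Field F] [Fintype F] (R : Type) [Ring R] [Algebra F R] [Fintype R]
    (J : NonUnitalSubalgebra F R) : Subgroup Rˣ where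
  carrier := {u : Rˣ | ((u : R) - 1 ∈ J) ∧ (((u⁻¹ : Rˣ) : R) - 1 ∈ J)}
  one_mem' := by
    constructor <;> · simp only [Units.val_one, inv_one, sub_self]; exact J.zero_mem
  mul_mem' := by
    rintro u v ⟨hu1, hu2⟩ ⟨hv1, hv2⟩
    constructor
    · have h : ((u * v : Rˣ) : R) - 1 =
          ((u : R) - 1) * ((v : R) - 1) + ((u : R) - 1) + ((v : R) - 1) := by
        push_cast; noncomm_ring
      rw [h]
      exact add_mem (add_mem (mul_mem hu1 hv1) hu1) hv1
    · have h : (((u * v)⁻¹ : Rˣ) : R) - 1 =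
          (((v⁻¹ : Rˣ) : R) - 1) * (((u⁻¹ : Rˣ) : R) - 1) +
            (((v⁻¹ : Rˣ) : R) - 1) + (((u⁻¹ : Rˣ) : R) - 1) := by
        rw [mul_inv_rev]; push_cast; noncomm_ring
      rw [h]
      exact add_mem (add_mem (mul_mem hv2 hu2) hv2) hu2
  inv_mem' := by
    rintro u ⟨h1, h2⟩
    exact ⟨h2, by simpa using h1⟩

theorem mem_algGroup {J : NonUnitalSubalgebra F R} {u : Rˣ} :
    u ∈ algGroup F R J ↔ ((u : R) - 1 ∈ J) ∧ (((u⁻¹ : Rˣ) : R) - 1 ∈ J) :=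
  Iff.rfl

/-- The element `X ∈ J` such that `g = 1 + X`. -/
def gElt {J : NonUnitalSubalgebra F R} (g : ↥(algGroup F R J)) : ↥J :=
  ⟨((g : Rˣ) : R) - 1, g.2.1⟩

/-- The function `θ_λ(1+X) = θ(λ(X))` on the algebra group `1 + J`. -/
def thetaFn (θ : AddChar F ℂ) (J : NonUnitalSubalgebra F R) (lam : ↥J →ₗ[F] F) :
    ↥(algGroup F R J) → ℂ :=
  fun g => θ (lam (gElt g))

/-- Left multiplication by the group element `g` as a linear endomorphism of `J`. -/
def lmulMap {J : NonUnitalSubalgebra F R} (g : ↥(algGroup F R J)) : ↥J →ₗ[F] ↥J where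
  toFun X := ⟨((g : Rˣ) : R) * (X : R), by
    have h : ((g : Rˣ) : R) * (X : R) = (((g : Rˣ) : R) - 1) * (X : R) + (X : R) := by
      noncomm_ring
    rw [h]; exact add_mem (mul_mem g.2.1 X.2) X.2⟩
  map_add' X Y := by ext; simp [mul_add]
  map_smul' c X := by ext; simp [mul_smul_comm]

/-- Right multiplication by the group element `g` as a linear endomorphism of `J`. -/
def rmulMap {J : NonUnitalSubalgebra F R} (g : ↥(algGroup F R J)) : ↥J →ₗ[F] ↥J where
  toFun X := ⟨(X : R) * ((g : Rˣ) : R), by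
    have h : (X : R) * ((g : Rˣ) : R) = (X : R) * (((g : Rˣ) : R) - 1) + (X : R) := by
      noncomm_ring
    rw [h]; exact add_mem (mul_mem X.2 g.2.1) X.2⟩
  map_add' X Y := by ext; simp [add_mul]
  map_smul' c X := by ext; simp [smul_mul_assoc]

/-- The left action of `G` on the dual space: `(gλ)(X) = λ(g⁻¹ X)`. -/
def leftAct {J : NonUnitalSubalgebra F R} (g : ↥(algGroup F R J)) (lam : ↥J →ₗ[F] F) :
    ↥J →ₗ[F] F :=
  lam.comp (lmulMap g⁻¹)

/-- The right action of `G` on the dual space: `(λg)(X) = λ(X g⁻¹)`. -/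
def rightAct {J : NonUnitalSubalgebra F R} (g : ↥(algGroup F R J)) (lam : ↥J →ₗ[F] F) :
    ↥J →ₗ[F] F :=
  lam.comp (rmulMap g⁻¹)

/-- The coadjoint action of `G` on the dual space: `λ^g(X) = λ(g X g⁻¹)`. -/
def coAct {J : NonUnitalSubalgebra F R} (g : ↥(algGroup F R J)) (lam : ↥J →ₗ[F] F) :
    ↥J →ₗ[F] F :=
  lam.comp ((lmulMap g).comp (rmulMap g⁻¹))

/-- The left orbit `Gλ`. -/
def leftOrbit (J : NonUnitalSubalgebra F R) (lam : ↥J →ₗ[F] F) : Set (↥J →ₗ[F] F) :=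
  Set.range fun g : ↥(algGroup F R J) => leftAct g lam

/-- The right orbit `λG`. -/
def rightOrbit (J : NonUnitalSubalgebra F R) (lam : ↥J →ₗ[F] F) : Set (↥J →ₗ[F] F) :=
  Set.range fun g : ↥(algGroup F R J) => rightAct g lam

/-- The two-sided orbit `GλG`. -/
def twoOrbit (J : NonUnitalSubalgebra F R) (lam : ↥J →ₗ[F] F) : Set (↥J →ₗ[F] F) :=
  {mu | ∃ g h : ↥(algGroup F R J), mu = leftAct g (rightAct h lam)}

/-- The coadjoint orbit `λ^G`. -/
def coOrbit (J : NonUnitalSubalgebra F R) (lam : ↥J →ₗ[F] F) : Set (↥J →ₗ[F] F) :=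
  Set.range fun g : ↥(algGroup F R J) => coAct g lam

/-- The right orbit of `λ` under a subgroup `H` of the algebra group. -/
def rightOrbitUnder (J : NonUnitalSubalgebra F R) (H : Subgroup ↥(algGroup F R J))
    (lam : ↥J →ₗ[F] F) : Set (↥J →ₗ[F] F) :=
  {mu | ∃ s ∈ H, mu = rightAct s lam}

/-- The Kirillov function `ψ_λ = |λ^G|^{-1/2} ∑_{μ ∈ λ^G} θ_μ`. -/
def kirillov (θ : AddChar F ℂ) (J : NonUnitalSubalgebra F R) (lam : ↥J →ₗ[F] F) :
    ↥(algGroup F R J) → ℂ :=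
  fun g => ((Real.sqrt (Nat.card ↥(coOrbit J lam)) : ℂ))⁻¹ *
    ∑ᶠ mu ∈ coOrbit J lam, thetaFn θ J mu g

/-- The supercharacter `χ_λ = (|Gλ|/|GλG|) ∑_{μ ∈ GλG} θ_μ`. -/
def superchar (θ : AddChar F ℂ) (J : NonUnitalSubalgebra F R) (lam : ↥J →ₗ[F] F) :
    ↥(algGroup F R J) → ℂ :=
  fun g => ((Nat.card ↥(leftOrbit J lam) : ℂ) / (Nat.card ↥(twoOrbit J lam) : ℂ)) *
    ∑ᶠ mu ∈ twoOrbit J lam, thetaFn θ J mu g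

/-! ### The subalgebras `𝔩_λ`, `𝔰_λ` and their iterates -/

/-- The extension of `λ : J → F` by zero to all of `R`. -/
def lamE (J : NonUnitalSubalgebra F R) (lam : ↥J →ₗ[F] F) (x : R) : F :=
  if h : x ∈ J then lam ⟨x, h⟩ else 0

theorem lamE_apply (J : NonUnitalSubalgebra F R) (lam : ↥J →ₗ[F] F) {x : R} (hx : x ∈ J) :
    lamE J lam x = lam ⟨x, hx⟩ := dif_pos hx

theorem lamE_zero (J : NonUnitalSubalgebra F R) (lam : ↥J →ₗ[F] F) : lamE J lam 0 = 0 := by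
  rw [lamE_apply J lam J.zero_mem]
  have h : (⟨(0 : R), J.zero_mem⟩ : ↥J) = 0 := Subtype.ext rfl
  rw [h, map_zero]

theorem lamE_add (J : NonUnitalSubalgebra F R) (lam : ↥J →ₗ[F] F) {x y : R}
    (hx : x ∈ J) (hy : y ∈ J) : lamE J lam (x + y) = lamE J lam x + lamE J lam y := by
  rw [lamE, lamE, lamE, dif_pos (add_mem hx hy), dif_pos hx, dif_pos hy]
  have h : (⟨x + y, add_mem hx hy⟩ : ↥J) = ⟨x, hx⟩ + ⟨y, hy⟩ := Subtype.ext rfl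
  rw [h, map_add]

theorem lamE_smul (J : NonUnitalSubalgebra F R) (lam : ↥J →ₗ[F] F) (c : F) {x : R}
    (hx : x ∈ J) : lamE J lam (c • x) = c * lamE J lam x := by
  rw [lamE, lamE, dif_pos (SMulMemClass.smul_mem c hx), dif_pos hx]
  have h : (⟨c • x, SMulMemClass.smul_mem c hx⟩ : ↥J) = c • ⟨x, hx⟩ := Subtype.ext rfl
  rw [h, map_smul]
  rfl

/-- The left kernel `𝔩` of the bilinear form `(X,Y) ↦ λ(XY)` restricted to `s × s`. -/
def lStep (J : NonUnitalSubalgebra F R) (lam : ↥J →ₗ[F] F)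
    (s : NonUnitalSubalgebra F R) (hs : s ≤ J) : NonUnitalSubalgebra F R where
  carrier := {x | x ∈ s ∧ ∀ y ∈ s, lamE J lam (x * y) = 0}
  zero_mem' := ⟨zero_mem s, fun y _ => by rw [zero_mul, lamE_zero]⟩
  add_mem' := by
    rintro a b ⟨ha1, ha2⟩ ⟨hb1, hb2⟩
    refine ⟨add_mem ha1 hb1, fun y hy => ?_⟩
    rw [add_mul, lamE_add J lam (J.mul_mem (hs ha1) (hs hy)) (J.mul_mem (hs hb1) (hs hy)),
      ha2 y hy, hb2 y hy, add_zero]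
  smul_mem' := by
    rintro c a ⟨ha1, ha2⟩
    refine ⟨SMulMemClass.smul_mem c ha1, fun y hy => ?_⟩
    rw [smul_mul_assoc, lamE_smul J lam c (J.mul_mem (hs ha1) (hs hy)), ha2 y hy, mul_zero]
  mul_mem' := by
    rintro a b ⟨ha1, ha2⟩ ⟨hb1, hb2⟩
    refine ⟨mul_mem ha1 hb1, fun y hy => ?_⟩
    rw [mul_assoc]
    exact ha2 (b * y) (mul_mem hb1 hy)

theorem lStep_le (J : NonUnitalSubalgebra F R) (lam : ↥J →ₗ[F] F)
    (s : NonUnitalSubalgebra F R) (hs : s ≤ J) : lStep J lam s hs ≤ s :=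
  fun _ hx => hx.1

/-- The left kernel `𝔰` of the bilinear form `(X,Y) ↦ λ(XY)` restricted to `s × 𝔩`. -/
def sStep (J : NonUnitalSubalgebra F R) (lam : ↥J →ₗ[F] F)
    (s : NonUnitalSubalgebra F R) (hs : s ≤ J) : NonUnitalSubalgebra F R where
  carrier := {x | x ∈ s ∧ ∀ y ∈ lStep J lam s hs, lamE J lam (x * y) = 0}
  zero_mem' := ⟨zero_mem s, fun y _ => by rw [zero_mul, lamE_zero]⟩
  add_mem' := by
    rintro a b ⟨ha1, ha2⟩ ⟨hb1, hb2⟩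
    refine ⟨add_mem ha1 hb1, fun y hy => ?_⟩
    rw [add_mul, lamE_add J lam (J.mul_mem (hs ha1) (hs hy.1)) (J.mul_mem (hs hb1) (hs hy.1)),
      ha2 y hy, hb2 y hy, add_zero]
  smul_mem' := by
    rintro c a ⟨ha1, ha2⟩
    refine ⟨SMulMemClass.smul_mem c ha1, fun y hy => ?_⟩
    rw [smul_mul_assoc, lamE_smul J lam c (J.mul_mem (hs ha1) (hs hy.1)), ha2 y hy, mul_zero]
  mul_mem' := by
    rintro a b ⟨ha1, ha2⟩ ⟨hb1, hb2⟩
    refine ⟨mul_mem ha1 hb1, fun y hy => ?_⟩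
    rw [mul_assoc]
    refine ha2 (b * y) ⟨mul_mem hb1 hy.1, fun z hz => ?_⟩
    rw [mul_assoc]
    refine hb2 (y * z) ⟨mul_mem hy.1 hz, fun w hw => ?_⟩
    rw [mul_assoc]
    exact hy.2 (z * w) (mul_mem hz hw)

theorem sStep_le (J : NonUnitalSubalgebra F R) (lam : ↥J →ₗ[F] F)
    (s : NonUnitalSubalgebra F R) (hs : s ≤ J) : sStep J lam s hs ≤ s :=
  fun _ hx => hx.1

/-- `𝔩_λ`: the left kernel of `(X,Y) ↦ λ(XY)` on `J × J`. -/
def lone (J : NonUnitalSubalgebra F R) (lam : ↥J →ₗ[F] F) : NonUnitalSubalgebra F R :=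
  lStep J lam J le_rfl

/-- `𝔰_λ`: the left kernel of `(X,Y) ↦ λ(XY)` on `J × 𝔩_λ`. -/
def sone (J : NonUnitalSubalgebra F R) (lam : ↥J →ₗ[F] F) : NonUnitalSubalgebra F R :=
  sStep J lam J le_rfl

theorem lone_le (J : NonUnitalSubalgebra F R) (lam : ↥J →ₗ[F] F) : lone J lam ≤ J :=
  lStep_le J lam J le_rfl

theorem sone_le (J : NonUnitalSubalgebra F R) (lam : ↥J →ₗ[F] F) : sone J lam ≤ J :=
  sStep_le J lam J le_rfl

/-- `𝔨_λ = 𝔩_λ ∩ ker λ`. -/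
def kone (J : NonUnitalSubalgebra F R) (lam : ↥J →ₗ[F] F) : NonUnitalSubalgebra F R where
  carrier := {x | x ∈ lone J lam ∧ lamE J lam x = 0}
  zero_mem' := ⟨zero_mem _, lamE_zero J lam⟩
  add_mem' := by
    rintro a b ⟨ha1, ha2⟩ ⟨hb1, hb2⟩
    exact ⟨add_mem ha1 hb1, by
      rw [lamE_add J lam (lone_le J lam ha1) (lone_le J lam hb1), ha2, hb2, add_zero]⟩
  smul_mem' := by
    rintro c a ⟨ha1, ha2⟩
    exact ⟨SMulMemClass.smul_mem c ha1, by
      rw [lamE_smul J lam c (lone_le J lam ha1), ha2, mul_zero]⟩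
  mul_mem' := by
    rintro a b ⟨ha1, ha2⟩ ⟨hb1, hb2⟩
    exact ⟨mul_mem ha1 hb1, ha1.2 b (lone_le J lam hb1)⟩

theorem kone_le (J : NonUnitalSubalgebra F R) (lam : ↥J →ₗ[F] F) : kone J lam ≤ lone J lam :=
  fun _ hx => hx.1

/-- The descending chain `𝔰_λ^0 ⊇ 𝔰_λ^1 ⊇ ⋯` (bundled with the proof `𝔰_λ^i ≤ J`). -/
def sChainAux (J : NonUnitalSubalgebra F R) (lam : ↥J →ₗ[F] F) :
    ℕ → {s : NonUnitalSubalgebra F R // s ≤ J}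
  | 0 => ⟨J, le_rfl⟩
  | n + 1 =>
    ⟨sStep J lam (sChainAux J lam n).1 (sChainAux J lam n).2,
      le_trans (sStep_le J lam (sChainAux J lam n).1 (sChainAux J lam n).2)
        (sChainAux J lam n).2⟩

/-- `𝔰_λ^i`. -/
def sChain (J : NonUnitalSubalgebra F R) (lam : ↥J →ₗ[F] F) (i : ℕ) :
    NonUnitalSubalgebra F R :=
  (sChainAux J lam i).1

/-- `𝔩_λ^{i+1}`. -/
def lChain (J : NonUnitalSubalgebra F R) (lam : ↥J →ₗ[F] F) (i : ℕ) :
    NonUnitalSubalgebra F R :=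
  lStep J lam (sChainAux J lam i).1 (sChainAux J lam i).2

/-- The terminal element `𝔰̄_λ` of the descending chain; the chain has stabilized by
stage `|R|` since it is a weakly decreasing chain of subalgebras of the finite algebra. -/
def sbar (J : NonUnitalSubalgebra F R) (lam : ↥J →ₗ[F] F) : NonUnitalSubalgebra F R :=
  sChain J lam (Fintype.card R)

theorem sbar_le (J : NonUnitalSubalgebra F R) (lam : ↥J →ₗ[F] F) : sbar J lam ≤ J :=
  (sChainAux J lam (Fintype.card R)).2

/-- The terminal element `𝔩̄_λ` of the ascending chain. -/
def lbar (J : NonUnitalSubalgebra F R) (lam : ↥J →ₗ[F] F) : NonUnitalSubalgebra F R :=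
  lStep J lam (sbar J lam) (sbar_le J lam)

theorem lbar_le (J : NonUnitalSubalgebra F R) (lam : ↥J →ₗ[F] F) : lbar J lam ≤ J :=
  le_trans (lStep_le J lam _ _) (sbar_le J lam)

/-! ### Algebra subgroups of an algebra group -/

/-- The algebra subgroup `1 + k` of `1 + J`, as a subgroup of the ambient algebra group. -/
def algSubgroup (k J : NonUnitalSubalgebra F R) : Subgroup ↥(algGroup F R J) :=
  (algGroup F R k).subgroupOf (algGroup F R J)

/-- `L_λ = 1 + 𝔩_λ` as a subgroup of `G`. -/
def Lgrp (J : NonUnitalSubalgebra F R) (lam : ↥J →ₗ[F] F) : Subgroup ↥(algGroup F R J) :=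
  algSubgroup (lone J lam) J

/-- `S_λ = 1 + 𝔰_λ` as a subgroup of `G`. -/
def Sgrp (J : NonUnitalSubalgebra F R) (lam : ↥J →ₗ[F] F) : Subgroup ↥(algGroup F R J) :=
  algSubgroup (sone J lam) J

/-- `L̄_λ = 1 + 𝔩̄_λ` as a subgroup of `G`. -/
def Lbarg (J : NonUnitalSubalgebra F R) (lam : ↥J →ₗ[F] F) : Subgroup ↥(algGroup F R J) :=
  algSubgroup (lbar J lam) J

/-- `S̄_λ = 1 + 𝔰̄_λ` as a subgroup of `G`. -/
def Sbarg (J : NonUnitalSubalgebra F R) (lam : ↥J →ₗ[F] F) : Subgroup ↥(algGroup F R J) :=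
  algSubgroup (sbar J lam) J

/-- Passing from an element of the subgroup `1 + k ≤ 1 + J` to an element of the
algebra group `1 + k` in its own right. -/
def toAlg {k J : NonUnitalSubalgebra F R} (x : ↥(algSubgroup k J)) : ↥(algGroup F R k) :=
  ⟨((x : ↥(algGroup F R J)) : Rˣ), Subgroup.mem_subgroupOf.mp x.2⟩

/-- The linear inclusion of a smaller subalgebra. -/
def inclMap {s J : NonUnitalSubalgebra F R} (h : s ≤ J) : ↥s →ₗ[F] ↥J where
  toFun x := ⟨(x : R), h x.2⟩
  map_add' x y := rfl
  map_smul' c x := rfl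

/-- Restriction of a functional on `J` to a smaller subalgebra. -/
def resTo {s J : NonUnitalSubalgebra F R} (h : s ≤ J) (lam : ↥J →ₗ[F] F) : ↥s →ₗ[F] F :=
  lam.comp (inclMap h)

/-- The character `ξ_λ = Ind_{L̄_λ}^G (θ_λ)`. -/
def xi (θ : AddChar F ℂ) (J : NonUnitalSubalgebra F R) (lam : ↥J →ₗ[F] F) :
    ↥(algGroup F R J) → ℂ :=
  indFun (Lbarg J lam) (fun x => thetaFn θ J lam ↑x)

/-- The set `Ξ_λ = {g λ s g⁻¹ : g ∈ G, s ∈ S̄_λ}`. -/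
def Xi (J : NonUnitalSubalgebra F R) (lam : ↥J →ₗ[F] F) : Set (↥J →ₗ[F] F) :=
  {nu | ∃ g : ↥(algGroup F R J), ∃ s ∈ Sbarg J lam, nu = coAct g (rightAct s lam)}

/-! ### Normality of algebra subgroups coming from ideals -/

theorem conj_mem_aux (s a : NonUnitalSubalgebra F R)
    (hl : ∀ x ∈ s, ∀ y ∈ a, x * y ∈ a) (hr : ∀ y ∈ a, ∀ x ∈ s, y * x ∈ a)
    (u : Rˣ) (hu1 : (u : R) - 1 ∈ s) (hu2 : ((u⁻¹ : Rˣ) : R) - 1 ∈ s)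
    (x : Rˣ) (hx : (x : R) - 1 ∈ a) : ((u * x * u⁻¹ : Rˣ) : R) - 1 ∈ a := by
  have h1 : (u : R) * ((u⁻¹ : Rˣ) : R) = 1 := Units.mul_inv u
  have key : ((u * x * u⁻¹ : Rˣ) : R) - 1 =
      ((u : R) - 1) * ((x : R) - 1) * (((u⁻¹ : Rˣ) : R) - 1) +
        ((u : R) - 1) * ((x : R) - 1) + ((x : R) - 1) * (((u⁻¹ : Rˣ) : R) - 1) +
        ((x : R) - 1) := by
    push_cast
    calc (u : R) * (x : R) * ((u⁻¹ : Rˣ) : R) - 1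
        = (u : R) * (x : R) * ((u⁻¹ : Rˣ) : R) - (u : R) * ((u⁻¹ : Rˣ) : R) := by rw [h1]
      _ = _ := by noncomm_ring
  rw [key]
  exact add_mem (add_mem (add_mem (hr _ (hl _ hu1 _ hx) _ hu2) (hl _ hu1 _ hx))
    (hr _ hx _ hu2)) hx

theorem algSubgroup_normal (s a : NonUnitalSubalgebra F R)
    (hl : ∀ x ∈ s, ∀ y ∈ a, x * y ∈ a) (hr : ∀ y ∈ a, ∀ x ∈ s, y * x ∈ a) :
    ((algGroup F R a).subgroupOf (algGroup F R s)).Normal := by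
  constructor
  intro n hn g
  rw [Subgroup.mem_subgroupOf] at hn ⊢
  have hginv : ((g⁻¹ : ↥(algGroup F R s)) : Rˣ) = ((g : Rˣ))⁻¹ := rfl
  have hcoe : ((g * n * g⁻¹ : ↥(algGroup F R s)) : Rˣ) = (g : Rˣ) * (n : Rˣ) * ((g : Rˣ))⁻¹ := by
    push_cast [hginv]; rfl
  rw [mem_algGroup]
  constructor
  · rw [hcoe]
    exact conj_mem_aux s a hl hr (g : Rˣ) (g : ↥(algGroup F R s)).2.1 (g : ↥(algGroup F R s)).2.2
      (n : Rˣ) hn.1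
  · have hinv : (((g * n * g⁻¹ : ↥(algGroup F R s)) : Rˣ))⁻¹ =
        (g : Rˣ) * ((n : Rˣ))⁻¹ * ((g : Rˣ))⁻¹ := by
      rw [hcoe]; group
    rw [hinv]
    exact conj_mem_aux s a hl hr (g : Rˣ) (g : ↥(algGroup F R s)).2.1 (g : ↥(algGroup F R s)).2.2
      ((n : Rˣ))⁻¹ hn.2

theorem lone_mul_mem (J : NonUnitalSubalgebra F R) (lam : ↥J →ₗ[F] F)
    {y z : R} (hy : y ∈ lone J lam) (hz : z ∈ J) : y * z ∈ lone J lam := by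
  refine ⟨J.mul_mem (lone_le J lam hy) hz, fun w hw => ?_⟩
  rw [mul_assoc]
  exact hy.2 (z * w) (J.mul_mem hz hw)

theorem sone_mul_lone_mem (J : NonUnitalSubalgebra F R) (lam : ↥J →ₗ[F] F)
    {x y : R} (hx : x ∈ sone J lam) (hy : y ∈ lone J lam) : x * y ∈ lone J lam := by
  refine ⟨J.mul_mem (sone_le J lam hx) (lone_le J lam hy), fun w hw => ?_⟩
  rw [mul_assoc]
  exact hx.2 (y * w) (lone_mul_mem J lam hy hw)

theorem kone_ideal_left (J : NonUnitalSubalgebra F R) (lam : ↥J →ₗ[F] F) :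
    ∀ x ∈ sone J lam, ∀ y ∈ kone J lam, x * y ∈ kone J lam := by
  intro x hx y hy
  exact ⟨sone_mul_lone_mem J lam hx hy.1, hx.2 y hy.1⟩

theorem kone_ideal_right (J : NonUnitalSubalgebra F R) (lam : ↥J →ₗ[F] F) :
    ∀ y ∈ kone J lam, ∀ x ∈ sone J lam, y * x ∈ kone J lam := by
  intro y hy x hx
  exact ⟨lone_mul_mem J lam hy.1 (sone_le J lam hx), hy.1.2 x (sone_le J lam hx)⟩

/-- `K_λ = 1 + 𝔨_λ` as a (normal) subgroup of `S_λ = 1 + 𝔰_λ`. -/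
def KgrpIn (J : NonUnitalSubalgebra F R) (lam : ↥J →ₗ[F] F) :
    Subgroup ↥(algGroup F R (sone J lam)) :=
  (algGroup F R (kone J lam)).subgroupOf (algGroup F R (sone J lam))

instance KgrpIn_normal (J : NonUnitalSubalgebra F R) (lam : ↥J →ₗ[F] F) :
    (KgrpIn J lam).Normal :=
  algSubgroup_normal (sone J lam) (kone J lam) (kone_ideal_left J lam) (kone_ideal_right J lam)

/-- `L_λ = 1 + 𝔩_λ` as a (normal) subgroup of `S_λ = 1 + 𝔰_λ`. -/
def LgrpIn (J : NonUnitalSubalgebra F R) (lam : ↥J →ₗ[F] F) :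
    Subgroup ↥(algGroup F R (sone J lam)) :=
  (algGroup F R (lone J lam)).subgroupOf (algGroup F R (sone J lam))

instance LgrpIn_normal (J : NonUnitalSubalgebra F R) (lam : ↥J →ₗ[F] F) :
    (LgrpIn J lam).Normal :=
  algSubgroup_normal (sone J lam) (lone J lam)
    (fun x hx y hy => sone_mul_lone_mem J lam hx hy)
    (fun y hy x hx => lone_mul_mem J lam hy (sone_le J lam hx))

/-! ### Characters of finite groups -/

theorem isCharacter_trace {G V : Type} [Group G] [AddCommGroup V] [Module ℂ V]
    [FiniteDimensional ℂ V] (ρ : Representation ℂ G V) :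
    IsCharacter G (fun g => LinearMap.trace ℂ V (ρ g)) :=
  ⟨FDRep.of ρ, rfl⟩

/-- The trace of a representation cut down by a commuting idempotent is a character. -/
theorem isCharacter_trace_comp {G V : Type} [Group G] [AddCommGroup V] [Module ℂ V]
    [FiniteDimensional ℂ V] (ρ : Representation ℂ G V) (P : V →ₗ[ℂ] V)
    (hP : ∀ v, P (P v) = P v) (hc : ∀ g v, ρ g (P v) = P (ρ g v)) :
    IsCharacter G (fun g => LinearMap.trace ℂ V (ρ g ∘ₗ P)) := by
  have hmem : ∀ g, ∀ v ∈ LinearMap.range P, ρ g v ∈ LinearMap.range P := by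
    rintro g _ ⟨v, rfl⟩
    exact ⟨ρ g v, (hc g v).symm⟩
  let σ : Representation ℂ G (LinearMap.range P) :=
    { toFun := fun g => (ρ g).restrict (hmem g)
      map_one' := by ext v; simp
      map_mul' := fun g h => by ext v; simp }
  convert isCharacter_trace σ using 2 with g
  have hr : ∀ v, (ρ g ∘ₗ P) v ∈ LinearMap.range P := fun v => ⟨ρ g v, (hc g v).symm⟩
  rw [← LinearMap.trace_restrict_eq_of_forall_mem (LinearMap.range P) (ρ g ∘ₗ P) hr]
  congr 1
  ext ⟨_, v, rfl⟩
  simp [σ, hP]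

/-- The trace of `φ ↦ A ∘ φ ∘ σ` is the number of fixed points of `σ` times the trace of `A`. -/
theorem trace_comp_perm {X W : Type} [Fintype X] [AddCommGroup W] [Module ℂ W]
    [FiniteDimensional ℂ W] (A : W →ₗ[ℂ] W) (σ : X → X) :
    LinearMap.trace ℂ (X → W) (LinearMap.pi fun x => A ∘ₗ LinearMap.proj (σ x)) =
      ∑ x : X, if σ x = x then LinearMap.trace ℂ W A else 0 := by
  let b := Module.finBasis ℂ W
  rw [LinearMap.trace_eq_matrix_trace ℂ (Pi.basis fun _ : X => b), Matrix.trace,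
    Fintype.sum_sigma]
  refine Finset.sum_congr rfl fun x _ => ?_
  rw [LinearMap.trace_eq_matrix_trace ℂ b, Matrix.trace]
  simp only [Matrix.diag_apply, LinearMap.toMatrix_apply, Pi.basis_repr, Pi.basis_apply,
    LinearMap.pi_apply, LinearMap.comp_apply, LinearMap.proj_apply]
  split_ifs with h
  · simp [h]
  · simp [Pi.single_eq_of_ne h]

theorem trace_inv_eq_conj {G V : Type} [Group G] [Fintype G] [AddCommGroup V] [Module ℂ V]
    [FiniteDimensional ℂ V] (ρ : Representation ℂ G V) (g : G) :
    LinearMap.trace ℂ V (ρ g⁻¹) = (starRingEnd ℂ) (LinearMap.trace ℂ V (ρ g)) := by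
  let b := Module.finBasis ℂ V
  let M : G → Matrix _ _ ℂ := fun g => LinearMap.toMatrix b b (ρ g)
  have hmul : ∀ g h, M (g * h) = M g * M h := fun g h => by
    simp only [M, map_mul, LinearMap.toMatrix_mul]
  have hone : M 1 = 1 := by simp [M]
  let H : Matrix _ _ ℂ := ∑ x : G, (M x).conjTranspose * M x
  have hH : (M g).conjTranspose * H * M g = H := by
    simp only [H, Finset.mul_sum, Finset.sum_mul]
    refine Fintype.sum_equiv (Equiv.mulRight g) _ _ fun x => ?_
    simp [hmul, Matrix.conjTranspose_mul, Matrix.mul_assoc]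
  have hpos : H.PosDef := by
    have : H = (M 1).conjTranspose * M 1 + ∑ x ∈ Finset.univ.erase (1 : G),
        (M x).conjTranspose * M x := (Finset.add_sum_erase _ _ (Finset.mem_univ _)).symm
    rw [this, hone]
    refine Matrix.PosDef.add_posSemidef (by simpa using Matrix.PosDef.one)
      (Matrix.posSemidef_sum _ fun x _ => Matrix.posSemidef_conjTranspose_mul_self _)
  have hu : IsUnit H.det := (Matrix.isUnit_iff_isUnit_det _).1 hpos.isUnit
  have hinv : M g⁻¹ = H⁻¹ * (M g).conjTranspose * H := by
    have h1 : M g * M g⁻¹ = 1 := by rw [← hmul, mul_inv_cancel, hone]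
    have h2 : H * M g⁻¹ = (M g).conjTranspose * H := by
      conv_lhs => rw [← hH]
      rw [Matrix.mul_assoc, h1, Matrix.mul_one]
    rw [Matrix.mul_assoc, ← h2, ← Matrix.mul_assoc, Matrix.nonsing_inv_mul _ hu, Matrix.one_mul]
  rw [LinearMap.trace_eq_matrix_trace ℂ b, LinearMap.trace_eq_matrix_trace ℂ b]
  change (M g⁻¹).trace = star (M g).trace
  rw [hinv, Matrix.trace_mul_cycle, Matrix.mul_nonsing_inv _ hu, Matrix.one_mul,
    Matrix.trace_conjTranspose]

theorem IsCharacter.exists_trace {G : Type} [Group G] {f : G → ℂ} (hf : IsCharacter G f) :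
    ∃ V : FDRep ℂ G, ∀ g, f g = LinearMap.trace ℂ V (V.ρ g) := by
  obtain ⟨V, rfl⟩ := hf
  exact ⟨V, fun _ => rfl⟩

theorem IsCharacter.conj {G : Type} [Group G] {f : G → ℂ} (hf : IsCharacter G f) (x g : G) :
    f (x * g * x⁻¹) = f g := by
  obtain ⟨V, rfl⟩ := hf
  exact V.char_conj g x

theorem IsCharacter.res {G : Type} [Group G] {f : G → ℂ} (hf : IsCharacter G f)
    (S : Subgroup G) : IsCharacter S (fun s => f s) := by
  obtain ⟨V, hV⟩ := hf.exists_trace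
  simp only [hV]
  exact isCharacter_trace (V.ρ.comp S.subtype)

theorem innerG_eq {G : Type} [Group G] [Fintype G] (f h : G → ℂ) :
    innerG G f h = (Fintype.card G : ℂ)⁻¹ * ∑ x : G, f x * (starRingEnd ℂ) (h x) := by
  rw [innerG, finsum_eq_sum_of_fintype, Nat.card_eq_fintype_card]

/-- The norm of a character is a natural number. -/
theorem IsCharacter.exists_norm_eq {G : Type} [Group G] [Fintype G] {f : G → ℂ}
    (hf : IsCharacter G f) : ∃ n : ℕ, innerG G f f = n := by
  obtain ⟨V, hV⟩ := hf.exists_trace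
  have : Invertible (Nat.card G : ℂ) := invertibleOfNonzero (by simp)
  refine ⟨_, Eq.trans ?_ (Representation.card_inv_mul_sum_char_mul_char_eq_finrank V.ρ V.ρ)⟩
  rw [innerG_eq, Nat.card_eq_fintype_card]
  simp only [hV, Representation.character, trace_inv_eq_conj]

theorem innerG_self {G : Type} [Group G] [Fintype G] (f : G → ℂ) :
    innerG G f f = (((Fintype.card G : ℝ)⁻¹ * ∑ x : G, ‖f x‖ ^ 2 : ℝ) : ℂ) := by
  rw [innerG_eq]
  push_cast
  simp only [Complex.mul_conj, Complex.normSq_eq_norm_sq, Complex.ofReal_pow]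

theorem eq_zero_of_innerG_self {G : Type} [Group G] [Fintype G] {f : G → ℂ}
    (h : innerG G f f = 0) (x : G) : f x = 0 := by
  rw [innerG_self, Complex.ofReal_eq_zero, mul_eq_zero, inv_eq_zero,
    Finset.sum_eq_zero_iff_of_nonneg fun _ _ => by positivity] at h
  have := h.resolve_left (by simp) x (Finset.mem_univ x)
  simpa using this

theorem innerG_sub_left {G : Type} [Group G] [Fintype G] (f h k : G → ℂ) :
    innerG G (f - h) k = innerG G f k - innerG G h k := by
  simp only [innerG_eq, Pi.sub_apply, sub_mul, Finset.sum_sub_distrib, mul_sub]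

theorem conj_innerG {G : Type} [Group G] [Fintype G] (f h : G → ℂ) :
    (starRingEnd ℂ) (innerG G f h) = innerG G h f := by
  simp only [innerG_eq, map_mul, map_inv₀, map_natCast, map_sum, Complex.conj_conj]
  simp only [mul_comm]

theorem innerG_sub_right {G : Type} [Group G] [Fintype G] (f h k : G → ℂ) :
    innerG G k (f - h) = innerG G k f - innerG G k h := by
  rw [← conj_innerG, innerG_sub_left, map_sub, conj_innerG, conj_innerG]

/-- If `h` has positive integral norm equal to its inner product with the norm-one function `f`,
then `h = f`. -/
theorem eq_of_innerG_eq_natCast {G : Type} [Group G] [Fintype G] {f h : G → ℂ} {n : ℕ}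
    (hn : n ≠ 0) (hf : innerG G f f = 1) (hh : innerG G h h = n) (hhf : innerG G h f = n) :
    h = f := by
  have hfh : innerG G f h = n := by rw [← conj_innerG, hhf, map_natCast]
  have key : innerG G (f - h) (f - h) = ((1 - n : ℝ) : ℂ) := by
    rw [innerG_sub_left, innerG_sub_right, innerG_sub_right, hf, hh, hhf, hfh]
    push_cast
    ring
  have hnn : (0 : ℝ) ≤ 1 - n := by
    have h2 := innerG_self (f - h)
    rw [key, Complex.ofReal_inj] at h2
    rw [h2]
    positivity
  have hn1 : n = 1 := by
    have : (n : ℝ) ≤ 1 := by linarith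
    have : n ≤ 1 := by exact_mod_cast this
    omega
  subst hn1
  funext x
  have := eq_zero_of_innerG_self (by simpa using key) x
  exact (sub_eq_zero.1 this).symm

/-! ### Induction from a subgroup -/

/-- Extension by zero of a function on a subgroup. -/
def extendZero {G : Type} [Group G] (S : Subgroup G) (ψ : S → ℂ) (g : G) : ℂ :=
  if h : g ∈ S then ψ ⟨g, h⟩ else 0

theorem extendZero_coe {G : Type} [Group G] (S : Subgroup G) (ψ : S → ℂ) (s : S) :
    extendZero S ψ s = ψ s := dif_pos s.2

theorem extendZero_of_mem {G : Type} [Group G] {S : Subgroup G} (ψ : S → ℂ) {g : G}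
    (h : g ∈ S) : extendZero S ψ g = ψ ⟨g, h⟩ := dif_pos h

theorem extendZero_of_notMem {G : Type} [Group G] {S : Subgroup G} (ψ : S → ℂ) {g : G}
    (h : g ∉ S) : extendZero S ψ g = 0 := dif_neg h

theorem indFun_eq {G : Type} [Group G] [Fintype G] (S : Subgroup G) (ψ : S → ℂ) (g : G) :
    indFun S ψ g = (Fintype.card S : ℂ)⁻¹ * ∑ x : G, extendZero S ψ (x * g * x⁻¹) := by
  rw [indFun, finsum_eq_sum_of_fintype, Nat.card_eq_fintype_card]
  rfl

theorem sum_extendZero_mul {G : Type} [Group G] [Fintype G] (S : Subgroup G) (ψ : S → ℂ)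
    (k : G → ℂ) : ∑ g : G, extendZero S ψ g * k g = ∑ s : S, ψ s * k s := by
  have h : ∑ s : S, ψ s * k s = ∑ s : S, extendZero S ψ s * k s :=
    Finset.sum_congr rfl fun s _ => by rw [extendZero_coe]
  rw [h, ← Finset.sum_subtype (Finset.univ.filter (· ∈ S)) (by simp)
    (fun g => extendZero S ψ g * k g), Finset.sum_filter_of_ne]
  intro x _ hx
  by_contra hS
  exact hx (by rw [extendZero_of_notMem ψ hS, zero_mul])

theorem IsCharacter.indFun {G : Type} [Group G] [Fintype G] {S : Subgroup G} {ψ : S → ℂ}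
    (hψ : IsCharacter S ψ) : IsCharacter G (indFun S ψ) := by
  obtain ⟨W, hW⟩ := hψ.exists_trace
  let ρ : Representation ℂ G (G → W) :=
    { toFun := fun g => LinearMap.funLeft ℂ W (· * g)
      map_one' := by ext; simp [LinearMap.funLeft]
      map_mul' := fun g h => by
        apply LinearMap.ext; intro v; funext x; simp [LinearMap.funLeft, mul_assoc] }
  let T : S → (G → W) →ₗ[ℂ] (G → W) := fun s =>
    LinearMap.pi fun x => W.ρ s ∘ₗ LinearMap.proj (((s⁻¹ : S) : G) * x)
  have hT : ∀ s v x, T s v x = W.ρ s (v (((s⁻¹ : S) : G) * x)) := fun _ _ _ => rfl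
  have hTT : ∀ s t v, T s (T t v) = T (s * t) v := fun s t v => by
    funext x
    simp [hT, mul_assoc]
  let P : (G → W) →ₗ[ℂ] (G → W) := (Fintype.card S : ℂ)⁻¹ • ∑ s : S, T s
  have hPv : ∀ v, P v = (Fintype.card S : ℂ)⁻¹ • ∑ s : S, T s v := fun v => by
    simp [P]
  have hcard : (Fintype.card S : ℂ) ≠ 0 := by simp
  have hTP : ∀ s v, T s (P v) = P v := fun s v => by
    rw [hPv, map_smul, map_sum]
    congr 1
    exact Fintype.sum_equiv (Equiv.mulLeft s) _ _ fun t => hTT s t v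
  have hP : ∀ v, P (P v) = P v := fun v => by
    rw [hPv (P v)]
    simp only [hTP, Finset.sum_const, Finset.card_univ]
    rw [← Nat.cast_smul_eq_nsmul ℂ, smul_smul, inv_mul_cancel₀ hcard, one_smul]
  have hρT : ∀ g s v, ρ g (T s v) = T s (ρ g v) := fun g s v => by
    funext x
    simp [ρ, hT, LinearMap.funLeft, mul_assoc]
  have hc : ∀ g v, ρ g (P v) = P (ρ g v) := fun g v => by
    rw [hPv, hPv, map_smul, map_sum]
    simp only [hρT]
  convert isCharacter_trace_comp ρ P hP hc using 2 with g
  have hcomp : ρ g ∘ₗ P = (Fintype.card S : ℂ)⁻¹ • ∑ s : S,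
      LinearMap.pi fun x => W.ρ s ∘ₗ LinearMap.proj (((s⁻¹ : S) : G) * (x * g)) := by
    apply LinearMap.ext
    intro v
    rw [LinearMap.comp_apply, hPv, map_smul, map_sum]
    simp only [LinearMap.smul_apply, LinearMap.sum_apply]
    rfl
  rw [hcomp, map_smul, map_sum, indFun_eq, smul_eq_mul]
  congr 1
  simp only [trace_comp_perm, ← hW]
  rw [Finset.sum_comm]
  refine Finset.sum_congr rfl fun x _ => ?_
  have h1 := sum_extendZero_mul S ψ (fun y => if y = x * g * x⁻¹ then 1 else 0)
  simp only [mul_ite, mul_one, mul_zero, Finset.sum_ite_eq', Finset.mem_univ, if_true] at h1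
  rw [h1]
  refine Finset.sum_congr rfl fun s _ => ?_
  congr 1
  rw [S.coe_inv, inv_mul_eq_iff_eq_mul, eq_mul_inv_iff_mul_eq, eq_iff_iff, eq_comm]

theorem indFun_conj {G : Type} [Group G] [Fintype G] (S : Subgroup G) (ψ : S → ℂ) (y g : G) :
    indFun S ψ (y * g * y⁻¹) = indFun S ψ g := by
  rw [indFun_eq, indFun_eq]
  congr 1
  refine Fintype.sum_equiv (Equiv.mulRight y) _ _ fun x => ?_
  simp [mul_assoc]

/-- Frobenius reciprocity. -/
theorem innerG_indFun {G : Type} [Group G] [Fintype G] (S : Subgroup G) (ψ : S → ℂ)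
    {f : G → ℂ} (hf : ∀ x g, f (x * g * x⁻¹) = f g) :
    innerG G (indFun S ψ) f = innerG S ψ (fun s => f s) := by
  have key : ∀ x : G, ∑ g : G, extendZero S ψ (x * g * x⁻¹) * (starRingEnd ℂ) (f g) =
      ∑ s : S, ψ s * (starRingEnd ℂ) (f s) := fun x => by
    rw [← sum_extendZero_mul S ψ (fun g => (starRingEnd ℂ) (f g))]
    refine Fintype.sum_equiv (MulAut.conj x).toEquiv _ _ fun g => ?_
    simp [hf]
  rw [innerG_eq, innerG_eq]
  simp only [indFun_eq, mul_assoc, Finset.sum_mul]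
  rw [← Finset.mul_sum, Finset.sum_comm]
  simp only [← mul_assoc] at key ⊢
  simp only [key, Finset.sum_const, Finset.card_univ, nsmul_eq_mul]
  field_simp

theorem indFun_trans {G : Type} [Group G] [Fintype G] {L S : Subgroup G} (hLS : L ≤ S)
    (θ : G → ℂ) :
    indFun S (indFun (L.subgroupOf S) fun x => θ (x : S)) = indFun L fun x => θ x := by
  have hcard : Fintype.card (L.subgroupOf S) = Fintype.card L :=
    Fintype.card_congr (Subgroup.subgroupOfEquivOfLe hLS).toEquiv
  have key : ∀ y : G, extendZero S (indFun (L.subgroupOf S) fun x => θ (x : S)) y =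
      (Fintype.card L : ℂ)⁻¹ *
        ∑ s : S, extendZero L (fun x => θ x) ((s : G) * y * (s : G)⁻¹) := fun y => by
    by_cases hy : y ∈ S
    · rw [extendZero_of_mem _ hy, indFun_eq, hcard]
      congr 1
    · rw [extendZero_of_notMem _ hy, Finset.sum_eq_zero, mul_zero]
      intro s _
      refine extendZero_of_notMem _ fun h => hy ?_
      have := S.mul_mem (S.mul_mem (S.inv_mem s.2) (hLS h)) s.2
      simpa [mul_assoc] using this
  funext g
  rw [indFun_eq, indFun_eq]
  simp only [key]
  rw [← Finset.mul_sum, Finset.sum_comm]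
  have h2 : ∀ s : S, ∑ x : G, extendZero L (fun x => θ x)
      ((s : G) * (x * g * x⁻¹) * (s : G)⁻¹) =
      ∑ x : G, extendZero L (fun x => θ x) (x * g * x⁻¹) := fun s =>
    Fintype.sum_equiv (Equiv.mulLeft (s : G)) _ _ fun x => by simp [mul_assoc]
  simp only [h2, Finset.sum_const, Finset.card_univ, nsmul_eq_mul]
  field_simp

/-! ### Functions transforming under a linear character of a normal subgroup -/

/-- `θ` restricts to a unitary linear character of the normal subgroup `N` that is invariant under
conjugation. -/
structure IsInvariantLinear {H : Type} [Group H] (N : Subgroup H) (θ : H → ℂ) : Prop where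
  map_mul : ∀ l ∈ N, ∀ m ∈ N, θ (l * m) = θ l * θ m
  mul_conj : ∀ l ∈ N, θ l * (starRingEnd ℂ) (θ l) = 1
  conj_mem : ∀ l ∈ N, ∀ h, h * l * h⁻¹ ∈ N
  map_conj : ∀ l ∈ N, ∀ h, θ (h * l * h⁻¹) = θ l

/-- `f (l h) = θ l * f h` for all `l ∈ N`. -/
def IsEquivariant {H : Type} [Group H] (N : Subgroup H) (θ f : H → ℂ) : Prop :=
  ∀ l ∈ N, ∀ h, f (l * h) = θ l * f h

/-- The projection of a function onto its `θ`-equivariant part. -/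
def equivariantPart {H : Type} [Group H] [Fintype H] (N : Subgroup H) (θ f : H → ℂ) (h : H) : ℂ :=
  (Fintype.card N : ℂ)⁻¹ * ∑ l : N, (starRingEnd ℂ) (θ l) * f (l * h)

section Equivariant

variable {H : Type} [Group H] [Fintype H] {N : Subgroup H} {θ : H → ℂ}

theorem IsInvariantLinear.conj_eq (hθ : IsInvariantLinear N θ) {l m : H} (hl : l ∈ N)
    (hm : m ∈ N) : (starRingEnd ℂ) (θ m) = θ l * (starRingEnd ℂ) (θ (l * m)) := by
  rw [hθ.map_mul l hl m hm, RingHom.map_mul, ← mul_assoc, hθ.mul_conj l hl, one_mul]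

theorem isEquivariant_equivariantPart (hθ : IsInvariantLinear N θ) (f : H → ℂ) :
    IsEquivariant N θ (equivariantPart N θ f) := by
  intro l hl h
  rw [equivariantPart, equivariantPart, mul_left_comm, Finset.mul_sum _ _ (θ l)]
  congr 1
  refine Fintype.sum_equiv (Equiv.mulRight ⟨l, hl⟩) _ _ fun m => ?_
  rw [hθ.conj_eq hl m.2, hθ.map_mul l hl m m.2, Equiv.coe_mulRight, Subgroup.coe_mul,
    hθ.map_mul m m.2 l hl, mul_comm (θ l) (θ m), mul_assoc (m : H)]
  ring

theorem innerG_equivariantPart (hθ : IsInvariantLinear N θ) {φ : H → ℂ}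
    (hφ : IsEquivariant N θ φ) (f : H → ℂ) :
    innerG H φ (equivariantPart N θ f) = innerG H φ f := by
  have key : ∀ l : N, ∑ h : H, φ h * (θ l * (starRingEnd ℂ) (f (l * h))) =
      ∑ h : H, φ h * (starRingEnd ℂ) (f h) := fun l => by
    refine Fintype.sum_equiv (Equiv.mulLeft (l : H)) _ _ fun h => ?_
    rw [Equiv.coe_mulLeft, hφ l l.2]
    ring
  rw [innerG_eq, innerG_eq]
  congr 1
  simp only [equivariantPart, map_mul, map_inv₀, map_natCast, map_sum, Complex.conj_conj,
    Finset.mul_sum]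
  rw [Finset.sum_comm]
  simp only [mul_left_comm (φ _) (Fintype.card N : ℂ)⁻¹]
  simp only [← Finset.mul_sum, key]
  simp only [Finset.sum_const, Finset.card_univ, nsmul_eq_mul]
  field_simp

theorem IsCharacter.equivariantPart (hθ : IsInvariantLinear N θ) {f : H → ℂ}
    (hf : IsCharacter H f) : IsCharacter H (equivariantPart N θ f) := by
  obtain ⟨V, hV⟩ := hf.exists_trace
  let P : V →ₗ[ℂ] V := (Fintype.card N : ℂ)⁻¹ • ∑ l : N, (starRingEnd ℂ) (θ l) • V.ρ l
  have hPv : ∀ v, P v = (Fintype.card N : ℂ)⁻¹ • ∑ l : N, (starRingEnd ℂ) (θ l) • V.ρ l v :=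
    fun v => by simp [P]
  have hcard : (Fintype.card N : ℂ) ≠ 0 := by simp
  have hlP : ∀ (l : N) v, V.ρ l (P v) = θ l • P v := fun l v => by
    rw [hPv, map_smul, map_sum, smul_comm, Finset.smul_sum (r := θ l)]
    congr 1
    refine Fintype.sum_equiv (Equiv.mulLeft l) _ _ fun m => ?_
    rw [map_smul, hθ.conj_eq l.2 m.2, smul_smul, Equiv.coe_mulLeft, Subgroup.coe_mul, map_mul]
    rfl
  have hP : ∀ v, P (P v) = P v := fun v => by
    rw [hPv (P v)]
    simp only [hlP, smul_smul, mul_comm _ (θ _), hθ.mul_conj _ (Subtype.prop _), one_smul,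
      Finset.sum_const, Finset.card_univ]
    rw [← Nat.cast_smul_eq_nsmul ℂ, smul_smul, inv_mul_cancel₀ hcard, one_smul]
  have hc : ∀ g v, V.ρ g (P v) = P (V.ρ g v) := fun g v => by
    have : N.Normal := ⟨hθ.conj_mem⟩
    rw [hPv, hPv, map_smul, map_sum]
    congr 1
    refine Fintype.sum_equiv (MulAut.conjNormal g).toEquiv _ _ fun m => ?_
    have h1 : (((MulAut.conjNormal g).toEquiv m : N) : H) = g * m * g⁻¹ := rfl
    rw [map_smul, h1, hθ.map_conj m m.2, ← Module.End.mul_apply, ← Module.End.mul_apply,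
      ← map_mul, ← map_mul]
    simp
  convert isCharacter_trace_comp V.ρ P hP hc using 2 with g
  have hcomp : V.ρ g ∘ₗ P =
      (Fintype.card N : ℂ)⁻¹ • ∑ l : N, (starRingEnd ℂ) (θ l) • (V.ρ g * V.ρ l) := by
    apply LinearMap.ext
    intro v
    rw [LinearMap.comp_apply, hPv, map_smul, map_sum]
    simp
  rw [hcomp, map_smul, map_sum]
  simp only [map_smul, smul_eq_mul, IterChar.equivariantPart, hV, map_mul,
    LinearMap.trace_mul_comm ℂ (V.ρ g)]

theorem isEquivariant_indFun (hθ : IsInvariantLinear N θ) :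
    IsEquivariant N θ (indFun N fun x => θ x) := by
  intro l hl h
  rw [indFun_eq, indFun_eq, mul_left_comm, Finset.mul_sum _ _ (θ l)]
  congr 1
  refine Finset.sum_congr rfl fun x _ => ?_
  have h1 : x * (l * h) * x⁻¹ = (x * l * x⁻¹) * (x * h * x⁻¹) := by group
  have hm := hθ.conj_mem l hl x
  rw [h1]
  by_cases hx : x * h * x⁻¹ ∈ N
  · rw [extendZero_of_mem _ hx, extendZero_of_mem _ (N.mul_mem hm hx), hθ.map_mul _ hm _ hx,
      hθ.map_conj l hl]
  · rw [extendZero_of_notMem _ hx, extendZero_of_notMem, mul_zero]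
    rwa [N.mul_mem_cancel_left hm]

/-- An irreducible character lying over the invariant linear character `θ` is `θ`-equivariant. -/
theorem isEquivariant_of_mem_irrConstituents (hθ : IsInvariantLinear N θ) {f : H → ℂ}
    (hf : f ∈ IrrConstituents H (indFun N fun x => θ x)) : IsEquivariant N θ f := by
  obtain ⟨⟨hfc, hf1⟩, hpos⟩ := hf
  have he := isEquivariant_equivariantPart hθ f
  obtain ⟨n, hn⟩ := (hfc.equivariantPart hθ).exists_norm_eq
  have hn0 : n ≠ 0 := by
    rintro rfl
    refine hpos.ne' ?_
    rw [← innerG_equivariantPart hθ (isEquivariant_indFun hθ), innerG_eq]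
    simp [eq_zero_of_innerG_self (by simpa using hn)]
  have := eq_of_innerG_eq_natCast hn0 hf1 hn (by rw [← innerG_equivariantPart hθ he, hn])
  rwa [this] at he

end Equivariant

section Induction

variable {G : Type} [Group G] [Fintype G] {L S : Subgroup G} {θ : G → ℂ}

/-- Induction is isometric on equivariant functions if only the elements of `S` fix `θ` on
`L ∩ L^t`. -/
theorem innerG_indFun_indFun (hLS : L ≤ S)
    (hθ : IsInvariantLinear (L.subgroupOf S) fun s => θ s)
    (hsep : ∀ t, t ∉ S → ∃ l ∈ L, t * l * t⁻¹ ∈ L ∧ θ (t * l * t⁻¹) ≠ θ l)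
    {ψ ψ' : S → ℂ} (hψ : IsEquivariant (L.subgroupOf S) (fun s => θ s) ψ)
    (hψ' : IsEquivariant (L.subgroupOf S) (fun s => θ s) ψ')
    (hconj : ∀ x s, ψ' (x * s * x⁻¹) = ψ' s) :
    innerG G (indFun S ψ) (indFun S ψ') = innerG S ψ ψ' := by
  have key : ∀ t : G, ∑ s : S, ψ s * (starRingEnd ℂ) (extendZero S ψ' (t * s * t⁻¹)) =
      if t ∈ S then ∑ s : S, ψ s * (starRingEnd ℂ) (ψ' s) else 0 := fun t => by
    split_ifs with ht
    · refine Finset.sum_congr rfl fun s _ => ?_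
      rw [← hconj ⟨t, ht⟩ s, ← extendZero_coe S ψ']
      rfl
    · obtain ⟨l, hl, htl, hne⟩ := hsep t ht
      set A := ∑ s : S, ψ s * (starRingEnd ℂ) (extendZero S ψ' (t * s * t⁻¹)) with hA
      have h1 : A = θ l * (starRingEnd ℂ) (θ (t * l * t⁻¹)) * A := by
        conv_lhs => rw [hA]
        rw [hA, Finset.mul_sum]
        symm
        refine Fintype.sum_equiv (Equiv.mulLeft ⟨l, hLS hl⟩) _ _ fun s => ?_
        rw [Equiv.coe_mulLeft, hψ ⟨l, hLS hl⟩ hl, Subgroup.coe_mul]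
        have h2 : t * (l * (s : G)) * t⁻¹ = (t * l * t⁻¹) * (t * s * t⁻¹) := by group
        rw [h2]
        by_cases hx : t * (s : G) * t⁻¹ ∈ S
        · rw [extendZero_of_mem _ hx, extendZero_of_mem _ (S.mul_mem (hLS htl) hx)]
          have h3 := hψ' ⟨_, hLS htl⟩ htl ⟨_, hx⟩
          rw [MulMemClass.mk_mul_mk] at h3
          rw [h3, map_mul]
          ring
        · rw [extendZero_of_notMem _ hx, extendZero_of_notMem]
          · simp
          · rwa [S.mul_mem_cancel_left (hLS htl)]
      by_contra hA0
      have h4 : θ l * (starRingEnd ℂ) (θ (t * l * t⁻¹)) = 1 :=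
        mul_right_cancel₀ hA0 (by rw [one_mul, ← h1])
      have h5 := hθ.mul_conj ⟨_, hLS htl⟩ htl
      apply hne
      have hne0 : (starRingEnd ℂ) (θ (t * l * t⁻¹)) ≠ 0 := right_ne_zero_of_mul_eq_one h4
      exact mul_right_cancel₀ hne0 (by rw [h4]; exact h5)
  rw [innerG_indFun S ψ (indFun_conj S ψ'), innerG_eq, innerG_eq]
  congr 1
  simp only [indFun_eq, map_mul, map_inv₀, map_natCast, map_sum, Finset.mul_sum]
  rw [Finset.sum_comm]
  simp only [mul_left_comm (ψ _) (Fintype.card S : ℂ)⁻¹]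
  simp only [← Finset.mul_sum, key]
  rw [← Finset.sum_filter, Finset.sum_const, ← Fintype.card_subtype, nsmul_eq_mul]
  have : (Fintype.card S : ℂ) ≠ 0 := by simp
  field_simp

/-- Induction is a bijection between irreducible constituents when `S` is exactly the set of
elements intertwining the linear character `θ` of `L`. -/
theorem bijOn_indFun (hLS : L ≤ S) (hθ : IsInvariantLinear (L.subgroupOf S) fun s => θ s)
    (hsep : ∀ t, t ∉ S → ∃ l ∈ L, t * l * t⁻¹ ∈ L ∧ θ (t * l * t⁻¹) ≠ θ l) :
    Set.BijOn (fun ψ : S → ℂ => indFun S ψ)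
      (IrrConstituents S (indFun (L.subgroupOf S) fun x => θ (x : S)))
      (IrrConstituents G (indFun L fun x => θ x)) := by
  have hχ := isEquivariant_indFun hθ
  have hiso := fun {ψ ψ' : S → ℂ} => innerG_indFun_indFun (ψ := ψ) (ψ' := ψ') hLS hθ hsep
  refine ⟨fun ψ hψ => ?_, fun ψ hψ ψ' hψ' h => ?_, fun f hf => ?_⟩
  · have he := isEquivariant_of_mem_irrConstituents hθ hψ
    obtain ⟨⟨hc, h1⟩, hpos⟩ := hψ
    refine ⟨⟨hc.indFun, by rw [hiso he he hc.conj, h1]⟩, ?_⟩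
    rw [← indFun_trans hLS θ, hiso hχ he hc.conj]
    exact hpos
  · have he := isEquivariant_of_mem_irrConstituents hθ hψ
    have he' := isEquivariant_of_mem_irrConstituents hθ hψ'
    obtain ⟨⟨hc, h1⟩, -⟩ := hψ
    obtain ⟨⟨hc', h1'⟩, -⟩ := hψ'
    refine eq_of_innerG_eq_natCast one_ne_zero h1' (by simpa using h1) ?_
    rw [← hiso he he' hc'.conj, ← show indFun S ψ = indFun S ψ' from h, hiso he he hc.conj, h1,
      Nat.cast_one]
  · obtain ⟨⟨hc, h1⟩, hpos⟩ := hf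
    set ψ := equivariantPart (L.subgroupOf S) (fun s => θ s) (fun s : S => f s) with hψdef
    have he : IsEquivariant (L.subgroupOf S) (fun s => θ s) ψ :=
      isEquivariant_equivariantPart hθ _
    have hcψ : IsCharacter S ψ := (hc.res S).equivariantPart hθ
    obtain ⟨n, hn⟩ := hcψ.exists_norm_eq
    have hχf : innerG S (indFun (L.subgroupOf S) fun x => θ (x : S)) ψ =
        innerG G (indFun L fun x => θ x) f := by
      rw [innerG_equivariantPart hθ hχ, ← innerG_indFun S _ hc.conj, indFun_trans hLS θ]
    have hn0 : n ≠ 0 := by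
      rintro rfl
      refine hpos.ne' ?_
      rw [← hχf, innerG_eq]
      simp [eq_zero_of_innerG_self (by simpa using hn)]
    have hnorm : innerG G (indFun S ψ) (indFun S ψ) = n := by rw [hiso he he hcψ.conj, hn]
    have hindf : indFun S ψ = f := by
      refine eq_of_innerG_eq_natCast hn0 h1 hnorm ?_
      rw [innerG_indFun S ψ hc.conj, ← innerG_equivariantPart hθ he, hn]
    refine ⟨ψ, ⟨⟨hcψ, ?_⟩, ?_⟩, hindf⟩
    · rw [← hiso he he hcψ.conj, hindf, h1]
    · rw [hχf]
      exact hpos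

end Induction

/-! ### Algebra groups -/

section AlgebraGroup

variable {F : Type} [Field F] [Fintype F] {R : Type} [Ring R] [Algebra F R] [Fintype R]

theorem mem_algGroup_of_sub_one_mem {k : NonUnitalSubalgebra F R} {u : Rˣ}
    (hu : (u : R) - 1 ∈ k) : u ∈ algGroup F R k := by
  have hpow : ∀ n : ℕ, ((u ^ n : Rˣ) : R) - 1 ∈ k := fun n => by
    induction n with
    | zero => simp
    | succ n ih =>
      have h : ((u ^ (n + 1) : Rˣ) : R) - 1 = (((u ^ n : Rˣ) : R) - 1) * ((u : R) - 1) +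
          (((u ^ n : Rˣ) : R) - 1) + ((u : R) - 1) := by
        rw [pow_succ, Units.val_mul]
        noncomm_ring
      rw [h]
      exact add_mem (add_mem (mul_mem ih hu) ih) hu
  refine ⟨hu, ?_⟩
  have hinv : u⁻¹ = u ^ (orderOf u - 1) := by
    rw [inv_eq_iff_mul_eq_one, ← pow_succ', Nat.sub_add_cancel (orderOf_pos u), pow_orderOf_eq_one]
  rw [hinv]
  exact hpow _

theorem IsNil.exists_eq_one_add {J : NonUnitalSubalgebra F R} (hJ : IsNil J) {X : R}
    (hX : X ∈ J) : ∃ g : algGroup F R J, ((g : Rˣ) : R) = 1 + X := by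
  obtain ⟨N, hN⟩ := hJ
  have hnil : IsNilpotent X := ⟨N, by
    rw [← List.prod_replicate]
    exact hN _ (fun x hx => by rwa [List.eq_of_mem_replicate hx]) (by simp)⟩
  obtain ⟨u, hu⟩ := hnil.isUnit_one_add
  exact ⟨⟨u, mem_algGroup_of_sub_one_mem (by rw [hu]; simpa using hX)⟩, hu⟩

theorem mem_algSubgroup {k J : NonUnitalSubalgebra F R} {g : algGroup F R J} :
    g ∈ algSubgroup k J ↔ ((g : Rˣ) : R) - 1 ∈ k :=
  ⟨fun h => (Subgroup.mem_subgroupOf.1 h).1,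
    fun h => Subgroup.mem_subgroupOf.2 (mem_algGroup_of_sub_one_mem h)⟩

theorem gElt_bijective {J : NonUnitalSubalgebra F R} (hJ : IsNil J) :
    Function.Bijective (gElt : algGroup F R J → J) := by
  refine ⟨fun g h hgh => ?_, fun X => ?_⟩
  · have : ((g : Rˣ) : R) - 1 = ((h : Rˣ) : R) - 1 := congrArg Subtype.val hgh
    exact Subtype.ext (Units.ext (sub_left_injective this))
  · obtain ⟨g, hg⟩ := hJ.exists_eq_one_add X.2
    exact ⟨g, Subtype.ext (by simp [gElt, hg])⟩

variable {J : NonUnitalSubalgebra F R} {lam : J →ₗ[F] F}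

theorem lam_eq_lamE (x : J) : lam x = lamE J lam x := (lamE_apply J lam x.2).symm

theorem thetaFn_eq (θ : AddChar F ℂ) (g : algGroup F R J) :
    thetaFn θ J lam g = θ (lamE J lam (((g : Rˣ) : R) - 1)) := by
  rw [thetaFn, lam_eq_lamE]
  rfl

theorem mem_mul_of_mem {X : R} (hX : X ∈ J) (g : algGroup F R J) : ((g : Rˣ) : R) * X ∈ J :=
  (lmulMap g ⟨X, hX⟩).2

theorem lone_mul_group_mem {B : R} (hB : B ∈ lone J lam) (g : algGroup F R J) :
    B * ((g : Rˣ) : R) ∈ lone J lam := by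
  have h : B * ((g : Rˣ) : R) = B * (((g : Rˣ) : R) - 1) + B := by noncomm_ring
  rw [h]
  exact add_mem (lone_mul_mem J lam hB g.2.1) hB

theorem lone_mul_group_mem_iff {B : R} (g : algGroup F R J) :
    B * ((g : Rˣ) : R) ∈ lone J lam ↔ B ∈ lone J lam := by
  refine ⟨fun h => ?_, fun h => lone_mul_group_mem h g⟩
  have := lone_mul_group_mem h g⁻¹
  simpa [mul_assoc] using this

theorem lamE_mul_group {B : R} (hB : B ∈ lone J lam) (g : algGroup F R J) :
    lamE J lam (B * ((g : Rˣ) : R)) = lamE J lam B := by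
  have h : B * ((g : Rˣ) : R) = B * (((g : Rˣ) : R) - 1) + B := by noncomm_ring
  rw [h, lamE_add J lam (J.mul_mem (lone_le J lam hB) g.2.1) (lone_le J lam hB), hB.2 _ g.2.1,
    zero_add]

theorem conj_sub_one (x g : algGroup F R J) :
    (((x * g * x⁻¹ : algGroup F R J) : Rˣ) : R) - 1 =
      ((x : Rˣ) : R) * (((g : Rˣ) : R) - 1) * (((x⁻¹ : algGroup F R J) : Rˣ) : R) := by
  have h : ((x : Rˣ) : R) * (((x⁻¹ : algGroup F R J) : Rˣ) : R) = 1 := by simp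
  rw [mul_sub, sub_mul, mul_one, h]
  simp

theorem conj_mem_Lgrp_iff (x g : algGroup F R J) :
    x * g * x⁻¹ ∈ Lgrp J lam ↔ ((x : Rˣ) : R) * (((g : Rˣ) : R) - 1) ∈ lone J lam := by
  rw [Lgrp, mem_algSubgroup, conj_sub_one, lone_mul_group_mem_iff]

theorem thetaFn_conj (θ : AddChar F ℂ) {x g : algGroup F R J}
    (h : ((x : Rˣ) : R) * (((g : Rˣ) : R) - 1) ∈ lone J lam) :
    thetaFn θ J lam (x * g * x⁻¹) =
      θ (lamE J lam (((x : Rˣ) : R) * (((g : Rˣ) : R) - 1))) := by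
  rw [thetaFn_eq, conj_sub_one, lamE_mul_group h]

theorem Lgrp_le_Sgrp : Lgrp J lam ≤ Sgrp J lam := by
  intro g hg
  rw [Lgrp, mem_algSubgroup] at hg
  rw [Sgrp, mem_algSubgroup]
  exact ⟨lone_le J lam hg, fun y hy => hg.2 y (lone_le J lam hy)⟩

theorem lamE_group_mul {Y : R} (hY : Y ∈ J) (x : algGroup F R J) :
    lamE J lam (((x : Rˣ) : R) * Y) = lamE J lam ((((x : Rˣ) : R) - 1) * Y) + lamE J lam Y := by
  rw [← lamE_add J lam (J.mul_mem x.2.1 hY) hY]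
  congr 1
  noncomm_ring

theorem isInvariantLinear_thetaFn (θ : AddChar F ℂ) :
    IsInvariantLinear ((Lgrp J lam).subgroupOf (Sgrp J lam))
      fun s => thetaFn θ J lam (s : Sgrp J lam) := by
  have hmem : ∀ l ∈ (Lgrp J lam).subgroupOf (Sgrp J lam), ∀ h : Sgrp J lam,
      (((h : algGroup F R J) : Rˣ) : R) * ((((l : algGroup F R J) : Rˣ) : R) - 1) ∈
        lone J lam := by
    intro l hl h
    have hl' := mem_algSubgroup.1 (Subgroup.mem_subgroupOf.1 hl)
    have e : (((h : algGroup F R J) : Rˣ) : R) * ((((l : algGroup F R J) : Rˣ) : R) - 1) =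
        ((((h : algGroup F R J) : Rˣ) : R) - 1) * ((((l : algGroup F R J) : Rˣ) : R) - 1) +
          ((((l : algGroup F R J) : Rˣ) : R) - 1) := by noncomm_ring
    rw [e]
    exact add_mem (sone_mul_lone_mem J lam (mem_algSubgroup.1 h.2) hl') hl'
  refine ⟨fun l hl m hm => ?_, fun l _ => ?_, fun l hl h => ?_, fun l hl h => ?_⟩
  · have hl' := mem_algSubgroup.1 (Subgroup.mem_subgroupOf.1 hl)
    have hm' := mem_algSubgroup.1 (Subgroup.mem_subgroupOf.1 hm)
    have e : (((((l * m : Sgrp J lam) : algGroup F R J)) : Rˣ) : R) - 1 =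
        ((((l : algGroup F R J) : Rˣ) : R) - 1) * (((m : algGroup F R J) : Rˣ) : R) +
          ((((m : algGroup F R J) : Rˣ) : R) - 1) := by
      push_cast
      noncomm_ring
    simp only [thetaFn_eq]
    rw [e, lamE_add J lam (lone_le J lam (lone_mul_group_mem hl' _)) (lone_le J lam hm'),
      lamE_mul_group hl', AddChar.map_add_eq_mul]
  · simp only [thetaFn_eq]
    rw [← AddChar.map_neg_eq_conj, ← AddChar.map_add_eq_mul, add_neg_cancel,
      AddChar.map_zero_eq_one]
  · exact (conj_mem_Lgrp_iff (h : algGroup F R J) l).2 (hmem l hl h)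
  · have hl' := mem_algSubgroup.1 (Subgroup.mem_subgroupOf.1 hl)
    refine (thetaFn_conj θ (hmem l hl h)).trans ?_
    rw [thetaFn_eq, lamE_group_mul (lone_le J lam hl'), (mem_algSubgroup.1 h.2).2 _ hl', zero_add]

/-- If `λ((t - 1) Y)` vanishes for all `Y ∈ 𝔩_λ` with `t Y ∈ 𝔩_λ`, then it vanishes on `𝔩_λ`. -/
theorem lamE_sub_one_mul_eq_zero (hJ : IsNil J) (t : algGroup F R J)
    (ht : ∀ Y ∈ lone J lam, ((t : Rˣ) : R) * Y ∈ lone J lam →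
      lamE J lam ((((t : Rˣ) : R) - 1) * Y) = 0) :
    ∀ Y ∈ lone J lam, lamE J lam ((((t : Rˣ) : R) - 1) * Y) = 0 := by
  have : Module.Finite F J := Module.Finite.of_finite
  let f : J ⊕ J → J →ₗ[F] F := Sum.elim (fun Z => lam ∘ₗ LinearMap.mulRight F Z)
    (fun W => lam ∘ₗ lmulMap t ∘ₗ LinearMap.mulRight F W)
  have hl : ∀ Z Y : J, f (Sum.inl Z) Y = lamE J lam ((Y : R) * Z) := fun Z Y => lam_eq_lamE (Y * Z)
  have hr : ∀ W Y : J, f (Sum.inr W) Y = lamE J lam (((t : Rˣ) : R) * ((Y : R) * W)) :=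
    fun W Y => lam_eq_lamE (lmulMap t (Y * W))
  let K : J →ₗ[F] F := lam ∘ₗ LinearMap.mulLeft F (gElt t)
  have hK : ∀ Y : J, K Y = lamE J lam ((((t : Rˣ) : R) - 1) * Y) :=
    fun Y => lam_eq_lamE (gElt t * Y)
  have hspan : K ∈ Submodule.span F (Set.range f) := by
    refine FiniteDimensional.mem_span_of_iInf_ker_le_ker fun Y hY => ?_
    simp only [Submodule.mem_iInf, LinearMap.mem_ker] at hY
    rw [LinearMap.mem_ker, hK]
    refine ht Y ⟨Y.2, fun Z hZ => ?_⟩ ⟨mem_mul_of_mem Y.2 t, fun W hW => ?_⟩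
    · rw [← hl ⟨Z, hZ⟩, hY]
    · rw [mul_assoc, ← hr ⟨W, hW⟩, hY]
  have hex : ∃ Z W : J, ∀ Y : J, K Y = f (Sum.inl Z) Y + f (Sum.inr W) Y := by
    refine Submodule.span_induction (p := fun K _ => ∃ Z W : J, ∀ Y : J,
      K Y = f (Sum.inl Z) Y + f (Sum.inr W) Y) ?_ ?_ ?_ ?_ hspan
    · rintro _ ⟨Z | W, rfl⟩
      · exact ⟨Z, 0, fun Y => by simp [f]⟩
      · exact ⟨0, W, fun Y => by simp [f]⟩
    · exact ⟨0, 0, fun Y => by simp [f]⟩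
    · rintro K K' - - ⟨Z, W, h⟩ ⟨Z', W', h'⟩
      refine ⟨Z + Z', W + W', fun Y => ?_⟩
      rw [LinearMap.add_apply, h, h']
      simp only [f, Sum.elim_inl, Sum.elim_inr, LinearMap.comp_apply, LinearMap.mulRight_apply,
        mul_add, map_add]
      ring
    · rintro c K - ⟨Z, W, h⟩
      refine ⟨c • Z, c • W, fun Y => ?_⟩
      rw [LinearMap.smul_apply, h]
      simp only [f, Sum.elim_inl, Sum.elim_inr, LinearMap.comp_apply, LinearMap.mulRight_apply,
        mul_smul_comm, map_smul, smul_add]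
  obtain ⟨Z, W, hZW⟩ := hex
  obtain ⟨v, hv⟩ := hJ.exists_eq_one_add (J.neg_mem W.2)
  intro Y hY
  set Y' : R := Y * (((v⁻¹ : algGroup F R J) : Rˣ) : R) with hY'
  have hY'l : Y' ∈ lone J lam := lone_mul_group_mem hY v⁻¹
  have hY'J := lone_le J lam hY'l
  have hYv : Y' * ((v : Rˣ) : R) = Y := by simp [Y', mul_assoc]
  have hYW : Y = Y' + -(Y' * W) := by
    rw [← hYv, hv]
    noncomm_ring
  have h1 := hZW ⟨Y', hY'J⟩
  rw [hK, hl, hr] at h1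
  simp only [hY'l.2 Z Z.2, zero_add] at h1
  have h2 : lamE J lam Y' = lamE J lam Y := lamE_mul_group hY v⁻¹
  have h3 := lamE_group_mul (lam := lam) hY'J t
  have h4 := lamE_group_mul (lam := lam) (lone_le J lam hY) t
  have h5 : lamE J lam (((t : Rˣ) : R) * Y') = lamE J lam (((t : Rˣ) : R) * Y) +
      lamE J lam (((t : Rˣ) : R) * (Y' * W)) := by
    rw [← lamE_add J lam (mem_mul_of_mem (lone_le J lam hY) t)
      (mem_mul_of_mem (J.mul_mem hY'J W.2) t), ← mul_add]
    congr 2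
    conv_rhs => rw [hYW]
    abel
  linear_combination h1 + h2 + h3 - h4 - h5

theorem exists_thetaFn_conj_ne (hJ : IsNil J) {θ : AddChar F ℂ} (hθ : θ ≠ 1)
    {t : algGroup F R J} (ht : t ∉ Sgrp J lam) :
    ∃ l ∈ Lgrp J lam, t * l * t⁻¹ ∈ Lgrp J lam ∧
      thetaFn θ J lam (t * l * t⁻¹) ≠ thetaFn θ J lam l := by
  by_contra! hcon
  refine ht (mem_algSubgroup.2 ⟨t.2.1, lamE_sub_one_mul_eq_zero hJ t fun Y hY htY => ?_⟩)
  by_contra hne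
  obtain ⟨a, ha⟩ := AddChar.ne_one_iff.1 hθ
  set c := a / lamE J lam ((((t : Rˣ) : R) - 1) * Y) with hc
  have hcY : c • Y ∈ lone J lam := SMulMemClass.smul_mem c hY
  obtain ⟨l, hl⟩ := hJ.exists_eq_one_add (lone_le J lam hcY)
  have hl1 : ((l : Rˣ) : R) - 1 = c • Y := by rw [hl, add_sub_cancel_left]
  have htl : ((t : Rˣ) : R) * (((l : Rˣ) : R) - 1) ∈ lone J lam := by
    rw [hl1, mul_smul_comm]
    exact SMulMemClass.smul_mem c htY
  have h := hcon l (mem_algSubgroup.2 (by rwa [hl1])) ((conj_mem_Lgrp_iff t l).2 htl)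
  rw [thetaFn_conj θ htl, thetaFn_eq, hl1, lamE_group_mul (lone_le J lam hcY), mul_smul_comm,
    lamE_smul J lam c (J.mul_mem t.2.1 (lone_le J lam hY)), hc, div_mul_cancel₀ _ hne,
    AddChar.map_add_eq_mul] at h
  refine ha (mul_right_cancel₀ (b := θ (lamE J lam (c • Y))) ?_ (by rw [h, one_mul]))
  exact (θ.val_isUnit _).ne_zero

/-! ### The supercharacter as an induced character -/

theorem sum_theta_lamE_mul (hJ : IsNil J) {θ : AddChar F ℂ} (hθ : θ ≠ 1) {B : R} (hB : B ∈ J) :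
    ∑ y : algGroup F R J, θ (lamE J lam (B * ((y : Rˣ) : R))) =
      if B ∈ lone J lam then (Fintype.card (algGroup F R J) : ℂ) * θ (lamE J lam B) else 0 := by
  split_ifs with hBl
  · simp only [lamE_mul_group hBl, Finset.sum_const, Finset.card_univ, nsmul_eq_mul]
  · have h1 : ∀ y : algGroup F R J, θ (lamE J lam (B * ((y : Rˣ) : R))) =
        θ (lamE J lam B) * θ (lamE J lam (B * (gElt y : R))) := fun y => by
      rw [← AddChar.map_add_eq_mul, ← lamE_add J lam hB (J.mul_mem hB (gElt y).2)]
      congr 2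
      simp only [gElt]
      noncomm_ring
    simp only [h1]
    rw [← Finset.mul_sum, Fintype.sum_bijective gElt (gElt_bijective hJ) _
      (fun Z : J => θ (lamE J lam (B * (Z : R)))) fun _ => rfl]
    have hex : ∃ Z ∈ J, lamE J lam (B * Z) ≠ 0 := by
      by_contra! hcon
      exact hBl ⟨hB, hcon⟩
    obtain ⟨Z, hZ, hne⟩ := hex
    obtain ⟨a, ha⟩ := AddChar.ne_one_iff.1 hθ
    set c := a / lamE J lam (B * Z) with hc
    have hshift : ∑ Z : J, θ (lamE J lam (B * (Z : R))) =
        θ a * ∑ Z : J, θ (lamE J lam (B * (Z : R))) := by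
      rw [Finset.mul_sum]
      symm
      refine Fintype.sum_equiv (Equiv.addLeft (c • ⟨Z, hZ⟩ : J)) _ _ fun W => ?_
      have e : B * ((Equiv.addLeft (c • ⟨Z, hZ⟩ : J) W : J) : R) = c • (B * Z) + B * W := by
        simp [mul_add]
      rw [e, lamE_add J lam (SMulMemClass.smul_mem c (J.mul_mem hB hZ)) (J.mul_mem hB W.2),
        lamE_smul J lam c (J.mul_mem hB hZ), hc, div_mul_cancel₀ _ hne, AddChar.map_add_eq_mul]
    have : ∑ Z : J, θ (lamE J lam (B * (Z : R))) = 0 := by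
      by_contra h0
      exact ha (mul_right_cancel₀ h0 (by rw [one_mul, ← hshift]))
    rw [this, mul_zero]

theorem indFun_Lgrp_eq (hJ : IsNil J) {θ : AddChar F ℂ} (hθ : θ ≠ 1) (g : algGroup F R J) :
    indFun (Lgrp J lam) (fun x => thetaFn θ J lam x) g =
      (Fintype.card (Lgrp J lam) : ℂ)⁻¹ * (Fintype.card (algGroup F R J) : ℂ)⁻¹ *
        ∑ x : algGroup F R J, ∑ y : algGroup F R J,
          θ (lamE J lam (((x : Rˣ) : R) * (((g : Rˣ) : R) - 1) * ((y : Rˣ) : R))) := by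
  have hcard : (Fintype.card (algGroup F R J) : ℂ) ≠ 0 := by simp
  rw [indFun_eq, mul_assoc]
  congr 1
  rw [Finset.mul_sum]
  refine Finset.sum_congr rfl fun x _ => ?_
  rw [sum_theta_lamE_mul hJ hθ (mem_mul_of_mem g.2.1 x)]
  split_ifs with h
  · rw [extendZero_of_mem _ ((conj_mem_Lgrp_iff x g).2 h), thetaFn_conj θ h,
      inv_mul_cancel_left₀ hcard]
  · rw [extendZero_of_notMem _ fun h' => h ((conj_mem_Lgrp_iff x g).1 h'), mul_zero]

/-- Summing over the group is summing over the orbit, up to the order of the stabilizer. -/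
theorem sum_smul_eq {A X : Type} [Group A] [Fintype A] [MulAction A X] (a : X) (f : X → ℂ) :
    ∑ g : A, f (g • a) = (Fintype.card A : ℂ) / (Nat.card (MulAction.orbit A a) : ℂ) *
      ∑ᶠ x ∈ MulAction.orbit A a, f x := by
  classical
  have hfin : (MulAction.orbit A a).Finite := Set.finite_range _
  have : Fintype (MulAction.orbit A a) := hfin.fintype
  have hcard := MulAction.card_orbit_mul_card_stabilizer_eq_card_group A a
  have h0 : (Fintype.card (MulAction.orbit A a) : ℂ) ≠ 0 :=
    Nat.cast_ne_zero.2 (Fintype.card_pos_iff.2 (MulAction.nonempty_orbit a).to_subtype).ne'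
  choose c hc using fun x : MulAction.orbit A a => MulAction.mem_orbit_iff.1 x.2
  have hcs : ∀ (x : MulAction.orbit A a) (s : MulAction.stabilizer A a),
      (c x * (s : A)) • a = x := fun x s => by
    rw [mul_smul, MulAction.mem_stabilizer_iff.1 s.2, hc]
  have hbij : Function.Bijective
      fun p : MulAction.orbit A a × MulAction.stabilizer A a => c p.1 * (p.2 : A) := by
    rw [Fintype.bijective_iff_injective_and_card, Fintype.card_prod]
    refine ⟨?_, hcard⟩
    rintro ⟨x, s⟩ ⟨y, t⟩ h
    have hxy : x = y := Subtype.ext (by rw [← hcs x s, ← hcs y t]; exact congrArg (· • a) h)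
    subst hxy
    exact Prod.ext rfl (Subtype.ext (mul_left_cancel h))
  have h1 : ∑ g : A, f (g • a) =
      ∑ p : MulAction.orbit A a × MulAction.stabilizer A a, f p.1 :=
    (Fintype.sum_bijective _ hbij _ _ fun p => by rw [hcs]).symm
  rw [h1, Fintype.sum_prod_type, ← finsum_set_coe_eq_finsum_mem, finsum_eq_sum_of_fintype,
    Nat.card_eq_fintype_card, ← hcard]
  simp only [Finset.sum_const, Finset.card_univ, nsmul_eq_mul, ← Finset.mul_sum]
  push_cast
  rw [mul_div_cancel_left₀ _ h0]

/-- The left action of the algebra group on the dual space. -/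
abbrev leftMulAction (J : NonUnitalSubalgebra F R) :
    MulAction (algGroup F R J) (J →ₗ[F] F) where
  smul g mu := leftAct g mu
  one_smul mu := by
    ext X
    change mu _ = mu _
    congr 1
    ext
    simp [lmulMap]
  mul_smul g h mu := by
    ext X
    change mu _ = mu _
    congr 1
    ext
    simp [lmulMap, mul_assoc]

/-- The two-sided action of the algebra group on the dual space, made into a left action. -/
abbrev twoSidedMulAction (J : NonUnitalSubalgebra F R) :
    MulAction (algGroup F R J × algGroup F R J) (J →ₗ[F] F) where
  smul p mu := leftAct p.1 (rightAct p.2⁻¹ mu)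
  one_smul mu := by
    ext X
    change mu _ = mu _
    congr 1
    ext
    simp [lmulMap, rmulMap]
  mul_smul p q mu := by
    ext X
    change mu _ = mu _
    congr 1
    ext
    simp [lmulMap, rmulMap, mul_assoc]

theorem card_leftOrbit_mul_card_Lgrp :
    Nat.card (leftOrbit J lam) * Fintype.card (Lgrp J lam) = Fintype.card (algGroup F R J) := by
  let := leftMulAction J
  have hstab : MulAction.stabilizer (algGroup F R J) lam = Lgrp J lam := by
    ext g
    rw [MulAction.mem_stabilizer_iff, ← (Lgrp J lam).inv_mem_iff, Lgrp, mem_algSubgroup]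
    change leftAct g lam = lam ↔ _
    have h : ∀ X : J, leftAct g lam X = lamE J lam (((((g⁻¹ : algGroup F R J) : Rˣ) : R) - 1) * X) +
        lam X := fun X => by
      rw [lam_eq_lamE (lam := lam) X, ← lamE_group_mul X.2]
      exact lam_eq_lamE (lmulMap g⁻¹ X)
    constructor
    · intro hg
      refine ⟨(g⁻¹).2.1, fun Y hY => ?_⟩
      have := h ⟨Y, hY⟩
      rwa [hg, right_eq_add] at this
    · intro hg
      ext X
      rw [h, hg.2 X X.2, zero_add]
  have hcard := Nat.card_congr (MulAction.orbitProdStabilizerEquivGroup (algGroup F R J) lam)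
  rw [Nat.card_prod, hstab] at hcard
  rw [← Nat.card_eq_fintype_card, ← Nat.card_eq_fintype_card]
  exact hcard

theorem superchar_eq_indFun (hJ : IsNil J) {θ : AddChar F ℂ} (hθ : θ ≠ 1) :
    superchar θ J lam = indFun (Lgrp J lam) (fun x => thetaFn θ J lam x) := by
  funext g
  rw [indFun_Lgrp_eq hJ hθ]
  let := twoSidedMulAction J
  have horb : twoOrbit J lam = MulAction.orbit (algGroup F R J × algGroup F R J) lam := by
    ext mu
    constructor
    · rintro ⟨a, b, rfl⟩
      exact ⟨(a, b⁻¹), by change leftAct a (rightAct b⁻¹⁻¹ lam) = _; rw [inv_inv]⟩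
    · rintro ⟨⟨a, b⟩, rfl⟩
      exact ⟨a, b⁻¹, rfl⟩
  have hsum := sum_smul_eq (A := algGroup F R J × algGroup F R J) lam
    (fun mu => thetaFn θ J mu g)
  have hS : ∑ p : algGroup F R J × algGroup F R J, thetaFn θ J (p • lam) g =
      ∑ x : algGroup F R J, ∑ y : algGroup F R J,
        θ (lamE J lam (((x : Rˣ) : R) * (((g : Rˣ) : R) - 1) * ((y : Rˣ) : R))) := by
    rw [Fintype.sum_prod_type]
    refine Fintype.sum_equiv (Equiv.inv _) _ _ fun x => Finset.sum_congr rfl fun y _ => ?_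
    change θ (lam _) = _
    rw [lam_eq_lamE]
    simp [lmulMap, rmulMap, gElt]
  rw [← hS, hsum, superchar, ← horb, Fintype.card_prod, ← card_leftOrbit_mul_card_Lgrp (lam := lam)]
  have h1 : (Fintype.card (Lgrp J lam) : ℂ) ≠ 0 := by simp
  have h2 : (Nat.card (leftOrbit J lam) : ℂ) ≠ 0 := by
    intro h0
    have := card_leftOrbit_mul_card_Lgrp (lam := lam)
    rw [Nat.cast_eq_zero.1 h0, zero_mul] at this
    exact Fintype.card_ne_zero this.symm
  push_cast
  field_simp

end AlgebraGroup

theorem statement1 (F : Type) [Field F] [Fintype F]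
    (R : Type) [Ring R] [Algebra F R] [Fintype R]
    (J : NonUnitalSubalgebra F R) (hJ : IsNil J)
    (θ : AddChar F ℂ) (hθ : θ ≠ 1)
    (lam : ↥J →ₗ[F] F) :
    Set.BijOn (fun ψ : ↥(Sgrp J lam) → ℂ => indFun (Sgrp J lam) ψ)
      (IrrConstituents ↥(Sgrp J lam)
        (indFun ((Lgrp J lam).subgroupOf (Sgrp J lam))
          (fun x => thetaFn θ J lam ((x : ↥(Sgrp J lam)) : ↥(algGroup F R J)))))
      (IrrConstituents ↥(algGroup F R J) (superchar θ J lam)) := by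
  rw [superchar_eq_indFun hJ hθ]
  exact bijOn_indFun Lgrp_le_Sgrp (isInvariantLinear_thetaFn θ)
    fun t ht => exists_thetaFn_conj_ne hJ hθ ht

end IterChar
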